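/- arXiv:2405.15315 — 7 statements merged into one kernel-verified Lean document; each statement's English description precedes it below -/
import Mathlib

section
/- For any discrete 1-form A, any r-form Φ and any (r+1)-form Ω (r = 0 or 1) on the combinatorial N×M torus, (d_A^cΦ, Ω)_V = (Φ, δ_A^cΩ)_V. -/
open Matrix BigOperators

noncomputable section

/-- 2×2 complex matrices. -/
abbrev Mat : Type := Matrix (Fin 2) (Fin 2) ℂ

/-- A discrete 0-form on the combinatorial N×M torus. -/
abbrev Form0 (N M : ℕ) : Type := ZMod N → ZMod M → Mat
/-- A discrete 1-form (pair of component families). -/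
abbrev Form1 (N M : ℕ) : Type := Form0 N M × Form0 N M
/-- A discrete 2-form. -/
abbrev Form2 (N M : ℕ) : Type := ZMod N → ZMod M → Mat

variable {N M : ℕ}

/-- Coboundary on 0-forms. -/
def d0 (Φ : Form0 N M) : Form1 N M :=
  (fun k s => Φ (k + 1) s - Φ k s, fun k s => Φ k (s + 1) - Φ k s)

/-- Coboundary on 1-forms. -/
def d1 (Ω : Form1 N M) : Form2 N M :=
  fun k s => Ω.2 (k + 1) s - Ω.2 k s - Ω.1 k (s + 1) + Ω.1 k s

/-- Cup product of two 0-forms. -/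
def cup00 (Φ Ψ : Form0 N M) : Form0 N M := fun k s => Φ k s * Ψ k s

/-- Cup product of a 0-form and a 1-form. -/
def cup01 (Φ : Form0 N M) (Ω : Form1 N M) : Form1 N M :=
  (fun k s => Φ k s * Ω.1 k s, fun k s => Φ k s * Ω.2 k s)

/-- Cup product of a 1-form and a 0-form. -/
def cup10 (Ω : Form1 N M) (Φ : Form0 N M) : Form1 N M :=
  (fun k s => Ω.1 k s * Φ (k + 1) s, fun k s => Ω.2 k s * Φ k (s + 1))

/-- Cup product of a 0-form and a 2-form. -/
def cup02 (Φ : Form0 N M) (Ψ : Form2 N M) : Form2 N M := fun k s => Φ k s * Ψ k s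

/-- Cup product of a 2-form and a 0-form. -/
def cup20 (Ψ : Form2 N M) (Φ : Form0 N M) : Form2 N M :=
  fun k s => Ψ k s * Φ (k + 1) (s + 1)

/-- Cup product of two 1-forms. -/
def cup11 (Ω Θ : Form1 N M) : Form2 N M :=
  fun k s => Ω.1 k s * Θ.2 (k + 1) s - Ω.2 k s * Θ.1 k (s + 1)

/-- Star operator on 0-forms. -/
def star0 (Φ : Form0 N M) : Form2 N M := fun k s => Φ k s

/-- Star operator on 1-forms. -/
def star1 (Ω : Form1 N M) : Form1 N M :=
  (fun k s => -Ω.2 k (s - 1), fun k s => Ω.1 (k - 1) s)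

/-- Star operator on 2-forms. -/
def star2 (Ψ : Form2 N M) : Form0 N M := fun k s => Ψ (k - 1) (s - 1)

/-- Inverse star, taking 0-forms to 2-forms (inverse of `star2`). -/
def starInv0 (Φ : Form0 N M) : Form2 N M := fun k s => Φ (k + 1) (s + 1)

/-- Inverse star on 1-forms (inverse of `star1`). -/
def starInv1 (Ω : Form1 N M) : Form1 N M :=
  (fun k s => Ω.2 (k + 1) s, fun k s => -Ω.1 k (s + 1))

/-- Inverse star, taking 2-forms to 0-forms (inverse of `star0`). -/
def starInv2 (Ψ : Form2 N M) : Form0 N M := fun k s => Ψ k s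

/-- Codifferential on 1-forms. -/
def delta1 (Ω : Form1 N M) : Form0 N M :=
  fun k s => Ω.1 (k - 1) s - Ω.1 k s + Ω.2 k (s - 1) - Ω.2 k s

/-- Codifferential on 2-forms. -/
def delta2 (Ψ : Form2 N M) : Form1 N M :=
  (fun k s => Ψ k s - Ψ k (s - 1), fun k s => -(Ψ k s - Ψ (k - 1) s))

/-- Covariant exterior derivative on 0-forms: `d_A Φ = dΦ + A∪Φ − Φ∪A`. -/
def dA0 (A : Form1 N M) (Φ : Form0 N M) : Form1 N M :=
  d0 Φ + cup10 A Φ - cup01 Φ A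

/-- Covariant exterior derivative on 1-forms: `d_A Ω = dΩ + A∪Ω + Ω∪A`. -/
def dA1 (A : Form1 N M) (Ω : Form1 N M) : Form2 N M :=
  d1 Ω + cup11 A Ω + cup11 Ω A

/-- Adjoint covariant derivative on 1-forms:
`δ_A Ω = δΩ + ∗⁻¹(∗Ω ∪ ∗∗A − A ∪ ∗Ω)`. -/
def deltaA1 (A : Form1 N M) (Ω : Form1 N M) : Form0 N M :=
  delta1 Ω + starInv2 (cup11 (star1 Ω) (star1 (star1 A)) - cup11 A (star1 Ω))

/-- Adjoint covariant derivative on 2-forms: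
`δ_A Ψ = δΨ + ∗⁻¹(∗Ψ ∪ ∗∗A + A ∪ ∗Ψ)`. -/
def deltaA2 (A : Form1 N M) (Ψ : Form2 N M) : Form1 N M :=
  delta2 Ψ + starInv1 (cup01 (star2 Ψ) (star1 (star1 A)) + cup10 A (star2 Ψ))

/-- Covariant Laplacian on 0-forms (`δ_A` vanishes on 0-forms). -/
def lapA0 (A : Form1 N M) (Φ : Form0 N M) : Form0 N M := deltaA1 A (dA0 A Φ)

/-- Covariant Laplacian on 1-forms. -/
def lapA1 (A : Form1 N M) (Ω : Form1 N M) : Form1 N M :=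
  dA0 A (deltaA1 A Ω) + deltaA2 A (dA1 A Ω)

/-- Covariant Laplacian on 2-forms (`d_A` of a 2-form is a 3-form, hence zero). -/
def lapA2 (A : Form1 N M) (Ψ : Form2 N M) : Form2 N M := dA1 A (deltaA2 A Ψ)

/-- Discrete curvature of a 1-form `A`. -/
def curv (A : Form1 N M) : Form2 N M :=
  fun k s => A.2 (k + 1) s - A.2 k s - A.1 k (s + 1) + A.1 k s
    + A.1 k s * A.2 (k + 1) s - A.2 k s * A.1 k (s + 1)

/-- Inner product of 0-forms over the torus. -/
def inner0 [NeZero N] [NeZero M] (Φ Ω : Form0 N M) : ℂ :=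
  -(1 / 2) * ∑ k : ZMod N, ∑ s : ZMod M, Matrix.trace (Φ k s * Ω k s)

/-- Inner product of 1-forms over the torus. -/
def inner1 [NeZero N] [NeZero M] (Φ Ω : Form1 N M) : ℂ :=
  -(1 / 2) * ∑ k : ZMod N, ∑ s : ZMod M,
    Matrix.trace (Φ.1 k s * Ω.1 k s + Φ.2 k s * Ω.2 k s)

/-- Inner product of 2-forms over the torus. -/
def inner2 [NeZero N] [NeZero M] (Φ Ω : Form2 N M) : ℂ :=
  -(1 / 2) * ∑ k : ZMod N, ∑ s : ZMod M, Matrix.trace (Φ k s * Ω k s)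

/-- Pairing of a 2-form with the fundamental chain `V`: `⟨V,Ψ⟩ = Σ Ψ_{k,s}`. -/
def pairV [NeZero N] [NeZero M] (Ψ : Form2 N M) : Mat :=
  ∑ k : ZMod N, ∑ s : ZMod M, Ψ k s

/-- A matrix lies in su(2): traceless and skew-Hermitian. -/
def IsSU2 (X : Mat) : Prop := Matrix.trace X = 0 ∧ Xᴴ = -X

/-- An su(2)-valued 0-form (or 2-form). -/
def IsSU2Form0 (Φ : Form0 N M) : Prop := ∀ k s, IsSU2 (Φ k s)

/-- An su(2)-valued 1-form. -/
def IsSU2Form1 (Ω : Form1 N M) : Prop := ∀ k s, IsSU2 (Ω.1 k s) ∧ IsSU2 (Ω.2 k s)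

/-- Two functions on the torus that differ by a discrete divergence have the same sum. -/
theorem sum_eq_sum_of_sub_eq_divergence [NeZero N] [NeZero M] {F G : ZMod N → ZMod M → ℂ}
    (f g : ZMod N → ZMod M → ℂ)
    (h : ∀ k s, F k s - G k s = (f (k + 1) s - f k s) + (g k (s + 1) - g k s)) :
    ∑ k, ∑ s, F k s = ∑ k, ∑ s, G k s := by
  have hf : ∑ k, ∑ s, f (k + 1) s = ∑ k, ∑ s, f k s :=
    Equiv.sum_comp (Equiv.addRight (1 : ZMod N)) fun k => ∑ s, f k s
  have hg : ∑ k, ∑ s, g k (s + 1) = ∑ k, ∑ s, g k s :=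
    Finset.sum_congr rfl fun k _ => Equiv.sum_comp (Equiv.addRight (1 : ZMod M)) (g k)
  rw [← sub_eq_zero]
  simp only [← Finset.sum_sub_distrib, h]
  simp only [Finset.sum_add_distrib, Finset.sum_sub_distrib, hf, hg, sub_self, add_zero]

/-- For any discrete 1-form `A`, any `r`-form `Φ` and any `(r+1)`-form `Ω`
(`r = 0` or `1`) on the combinatorial N×M torus, `(d_A^cΦ, Ω)_V = (Φ, δ_A^cΩ)_V`. -/
theorem discrete_covariant_adjoint (N M : ℕ) [NeZero N] [NeZero M] (A : Form1 N M) :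
    (∀ (Φ : Form0 N M) (Ω : Form1 N M),
      inner1 (dA0 A Φ) Ω = inner0 Φ (deltaA1 A Ω)) ∧
    (∀ (Φ : Form1 N M) (Ω : Form2 N M),
      inner2 (dA1 A Φ) Ω = inner1 Φ (deltaA2 A Ω)) := by
  constructor
  · intro Φ Ω
    unfold inner1 inner0
    rw [sum_eq_sum_of_sub_eq_divergence
      (fun k s => trace (Φ k s * (Ω.1 (k - 1) s + Ω.1 (k - 1) s * A.1 (k - 1) s)))
      (fun k s => trace (Φ k s * (Ω.2 k (s - 1) + Ω.2 k (s - 1) * A.2 k (s - 1))))]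
    intro k s
    simp only [dA0, d0, cup10, cup01, deltaA1, delta1, starInv2, cup11, star1, Prod.fst_add,
      Prod.snd_add, Prod.fst_sub, Prod.snd_sub, Pi.add_apply, Pi.sub_apply, add_sub_cancel_right,
      trace_fin_two, Matrix.add_apply, Matrix.sub_apply, Matrix.neg_apply, mul_apply,
      Fin.sum_univ_two]
    ring
  · intro Φ Ω
    unfold inner2 inner1
    rw [sum_eq_sum_of_sub_eq_divergence
      (fun k s => trace (Φ.2 k s * (Ω (k - 1) s + Ω (k - 1) s * A.1 (k - 1) s)))
      (fun k s => -trace (Φ.1 k s * (Ω k (s - 1) + Ω k (s - 1) * A.2 k (s - 1))))]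
    intro k s
    simp only [dA1, d1, cup11, deltaA2, delta2, starInv1, cup01, cup10, star1, star2, Prod.fst_add,
      Prod.snd_add, Pi.add_apply, add_sub_cancel_right,
      trace_fin_two, Matrix.add_apply, Matrix.sub_apply, Matrix.neg_apply, mul_apply,
      Fin.sum_univ_two]
    ring
end
end

section
/- For any discrete 1-form A and any r-form Φ (r = 0, 1 or 2) on the combinatorial N×M torus, (Δ_A^cΦ, Φ)_V = (δ_A^cΦ, δ_A^cΦ)_V + (d_A^cΦ, d_A^cΦ)_V, where Δ_A^c = d_A^c δ_A^c + δ_A^c d_A^c. -/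
open Matrix BigOperators

noncomputable section

variable {N M : ℕ}

/-- Two lattice functions on the torus that differ by a discrete divergence have equal sums. -/
lemma sum_torus_eq_of_sub_eq_divergence {N M : ℕ} [NeZero N] [NeZero M]
    {R : Type*} [AddCommGroup R] {a b : ZMod N → ZMod M → R} (g h : ZMod N → ZMod M → R)
    (hab : ∀ k s, a k s - b k s = (g (k + 1) s - g k s) + (h k (s + 1) - h k s)) :
    ∑ k, ∑ s, a k s = ∑ k, ∑ s, b k s := by
  have hg : ∑ k, ∑ s, g (k + 1) s = ∑ k, ∑ s, g k s :=
    Equiv.sum_comp (Equiv.addRight (1 : ZMod N)) fun k => ∑ s, g k s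
  have hh : ∀ k, ∑ s, h k (s + 1) = ∑ s, h k s := fun k =>
    Equiv.sum_comp (Equiv.addRight (1 : ZMod M)) (h k)
  rw [← sub_eq_zero]
  simp only [← Finset.sum_sub_distrib, hab]
  simp only [Finset.sum_add_distrib, Finset.sum_sub_distrib, hg, hh, sub_self, add_zero]

/-- `δ_A` on 1-forms is adjoint to `d_A` on 0-forms. -/
lemma inner1_dA0 {N M : ℕ} [NeZero N] [NeZero M] (A : Form1 N M) (Φ : Form0 N M)
    (Ω : Form1 N M) : inner1 (dA0 A Φ) Ω = inner0 (deltaA1 A Ω) Φ := by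
  unfold inner1 inner0
  congr 1
  refine sum_torus_eq_of_sub_eq_divergence
    (fun k s => trace (Φ k s * (Ω.1 (k - 1) s + Ω.1 (k - 1) s * A.1 (k - 1) s)))
    (fun k s => trace (Φ k s * (Ω.2 k (s - 1) + Ω.2 k (s - 1) * A.2 k (s - 1)))) fun k s => ?_
  simp [dA0, d0, cup10, cup01, deltaA1, delta1, starInv2, cup11, star1, trace_fin_two,
    mul_apply, Fin.sum_univ_two]
  ring

/-- `δ_A` on 2-forms is adjoint to `d_A` on 1-forms. -/
lemma inner2_dA1 {N M : ℕ} [NeZero N] [NeZero M] (A Ω : Form1 N M) (Ψ : Form2 N M) :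
    inner2 (dA1 A Ω) Ψ = inner1 (deltaA2 A Ψ) Ω := by
  unfold inner1 inner2
  congr 1
  refine sum_torus_eq_of_sub_eq_divergence
    (fun k s => trace (Ω.2 k s * (Ψ (k - 1) s + Ψ (k - 1) s * A.1 (k - 1) s)))
    (fun k s => -trace (Ω.1 k s * (Ψ k (s - 1) + Ψ k (s - 1) * A.2 k (s - 1)))) fun k s => ?_
  simp [dA1, d1, cup10, cup01, deltaA2, delta2, starInv1, cup11, star1, star2, trace_fin_two,
    mul_apply, Fin.sum_univ_two]
  ring

lemma inner1_comm {N M : ℕ} [NeZero N] [NeZero M] (Ω Θ : Form1 N M) :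
    inner1 Ω Θ = inner1 Θ Ω := by
  simp only [inner1, trace_add, trace_mul_comm (Ω.1 _ _), trace_mul_comm (Ω.2 _ _)]

lemma inner1_add_left {N M : ℕ} [NeZero N] [NeZero M] (Ω Ω' Θ : Form1 N M) :
    inner1 (Ω + Ω') Θ = inner1 Ω Θ + inner1 Ω' Θ := by
  simp only [inner1, ← mul_add, ← Finset.sum_add_distrib, ← trace_add, Prod.fst_add,
    Prod.snd_add, Pi.add_apply, add_mul]
  simp only [add_add_add_comm]

/-- `(Δ_A^cΦ, Φ)_V = (δ_A^cΦ, δ_A^cΦ)_V + (d_A^cΦ, d_A^cΦ)_V` for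
`r`-forms, `r = 0, 1, 2` (for `r = 0` the term `δ_A^cΦ` vanishes, and for `r = 2`
the term `d_A^cΦ` is a 3-form, hence vanishes). -/
theorem discrete_covariant_laplacian_energy (N M : ℕ) [NeZero N] [NeZero M]
    (A : Form1 N M) :
    (∀ Φ : Form0 N M,
      inner0 (lapA0 A Φ) Φ = inner1 (dA0 A Φ) (dA0 A Φ)) ∧
    (∀ Ω : Form1 N M,
      inner1 (lapA1 A Ω) Ω
        = inner0 (deltaA1 A Ω) (deltaA1 A Ω) + inner2 (dA1 A Ω) (dA1 A Ω)) ∧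
    (∀ Ψ : Form2 N M,
      inner2 (lapA2 A Ψ) Ψ = inner1 (deltaA2 A Ψ) (deltaA2 A Ψ)) := by
  refine ⟨fun Φ => (inner1_dA0 A Φ _).symm, fun Ω => ?_, fun Ψ => ?_⟩
  · rw [lapA1, inner1_add_left, inner1_dA0, ← inner2_dA1]
  · rw [lapA2, inner2_dA1, inner1_comm]
end
end

section
/- Let A be a discrete 1-form on the combinatorial N×M torus with curvature F. Then the discrete Yang-Mills equation δ_A^cF = 0 holds if and only if for all (k,s) ∈ ℤ/Nℤ × ℤ/Mℤ: F_{k,s−1} − F_{k−1,s−1} + A¹_{k,s}F_{k,s−1} − F_{k−1,s−1}A¹_{k−1,s−1} = 0 and F_{k−1,s} − F_{k−1,s−1} + A²_{k,s}F_{k−1,s} − F_{k−1,s−1}A²_{k−1,s−1} = 0. -/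
open Matrix BigOperators

noncomputable section

variable {N M : ℕ}

/-- The first component of `δ_A Ψ`, evaluated one step back in the first direction. -/
theorem deltaA2_fst_sub_one {N M : ℕ} (A : Form1 N M) (Ψ : Form2 N M) (k : ZMod N) (s : ZMod M) :
    (deltaA2 A Ψ).1 (k - 1) s =
      Ψ (k - 1) s - Ψ (k - 1) (s - 1) + A.2 k s * Ψ (k - 1) s
        - Ψ (k - 1) (s - 1) * A.2 (k - 1) (s - 1) := by
  simp only [deltaA2, delta2, starInv1, cup01, cup10, star1, star2, Prod.fst_add, Prod.snd_add,
    Pi.add_apply, sub_add_cancel, add_sub_cancel_right, mul_neg]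
  abel

/-- The second component of `δ_A Ψ`, evaluated one step back in the second direction. -/
theorem deltaA2_snd_sub_one {N M : ℕ} (A : Form1 N M) (Ψ : Form2 N M) (k : ZMod N) (s : ZMod M) :
    (deltaA2 A Ψ).2 k (s - 1) =
      -(Ψ k (s - 1) - Ψ (k - 1) (s - 1) + A.1 k s * Ψ k (s - 1)
        - Ψ (k - 1) (s - 1) * A.1 (k - 1) (s - 1)) := by
  simp only [deltaA2, delta2, starInv1, cup01, cup10, star1, star2, Prod.fst_add, Prod.snd_add,
    Pi.add_apply, sub_add_cancel, add_sub_cancel_right, mul_neg]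
  abel

/-- the discrete Yang-Mills equation `δ_A^cF = 0` holds iff the
corresponding system of difference equations holds. -/
theorem discrete_yang_mills_deltaA_difference (N M : ℕ) [NeZero N] [NeZero M]
    (A : Form1 N M) :
    deltaA2 A (curv A) = 0 ↔
      ∀ (k : ZMod N) (s : ZMod M),
        curv A k (s - 1) - curv A (k - 1) (s - 1)
          + A.1 k s * curv A k (s - 1)
          - curv A (k - 1) (s - 1) * A.1 (k - 1) (s - 1) = 0 ∧
        curv A (k - 1) s - curv A (k - 1) (s - 1)
          + A.2 k s * curv A (k - 1) s
          - curv A (k - 1) (s - 1) * A.2 (k - 1) (s - 1) = 0 := by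
  constructor
  · intro h k s
    rw [← deltaA2_fst_sub_one, ← neg_eq_zero, ← deltaA2_snd_sub_one, h]
    exact ⟨rfl, rfl⟩
  · intro h
    refine Prod.ext (funext₂ fun k s => ?_) (funext₂ fun k s => ?_)
    · have := deltaA2_fst_sub_one A (curv A) (k + 1) s
      rwa [(h (k + 1) s).2, add_sub_cancel_right] at this
    · have := deltaA2_snd_sub_one A (curv A) k (s + 1)
      rwa [(h k (s + 1)).1, neg_zero, add_sub_cancel_right] at this
end
end

section
/- For any discrete 1-form A, any r-form Ω and any p-form Φ on the combinatorial N×M torus, the discrete covariant exterior derivative satisfies the Leibniz rule d_A^c(Ω∪Φ) = d_A^cΩ ∪ Φ + (−1)^r Ω ∪ d_A^cΦ. -/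
open Matrix BigOperators

noncomputable section

variable {N M : ℕ}

/-- Leibniz rule for the discrete covariant exterior derivative
`d_A^c(Ω∪Φ) = d_A^cΩ ∪ Φ + (−1)^r Ω ∪ d_A^cΦ` (in degrees `(r,p)` with `r + p ≥ 2`
both sides are 3-forms, hence zero, so those cases are vacuous). -/
theorem discrete_covariant_leibniz (N M : ℕ) [NeZero N] [NeZero M] (A : Form1 N M) :
    (∀ (Ω Φ : Form0 N M),
      dA0 A (cup00 Ω Φ) = cup10 (dA0 A Ω) Φ + cup01 Ω (dA0 A Φ)) ∧
    (∀ (Ω : Form0 N M) (Φ : Form1 N M),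
      dA1 A (cup01 Ω Φ) = cup11 (dA0 A Ω) Φ + cup02 Ω (dA1 A Φ)) ∧
    (∀ (Ω : Form1 N M) (Φ : Form0 N M),
      dA1 A (cup10 Ω Φ) = cup20 (dA1 A Ω) Φ - cup11 Ω (dA0 A Φ)) := by
  refine ⟨fun Ω Φ => ?_, fun Ω Φ => ?_, fun Ω Φ => ?_⟩
  · ext1 <;> funext k s <;>
      simp only [dA0, d0, cup00, cup10, cup01, Prod.fst_add, Prod.snd_add, Prod.fst_sub,
        Prod.snd_sub, Pi.add_apply, Pi.sub_apply] <;>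
      noncomm_ring
  · funext k s
    simp only [dA0, dA1, d0, d1, cup11, cup10, cup01, cup02, Prod.fst_add, Prod.snd_add,
      Prod.fst_sub, Prod.snd_sub, Pi.add_apply, Pi.sub_apply]
    noncomm_ring
  · funext k s
    simp only [dA0, dA1, d0, d1, cup11, cup10, cup01, cup20, Prod.fst_add, Prod.snd_add,
      Prod.fst_sub, Prod.snd_sub, Pi.add_apply, Pi.sub_apply]
    noncomm_ring
end
end

section
/- For any r-form Φ and any (2−r)-form Ω (r = 0, 1 or 2) on the combinatorial N×M torus, tr⟨V, Φ∪Ω⟩ = tr⟨V, Ω∪∗∗Φ⟩. -/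
open Matrix BigOperators

noncomputable section

variable {N M : ℕ}

theorem trace_pairV [NeZero N] [NeZero M] (Ψ : Form2 N M) :
    Matrix.trace (pairV Ψ) = ∑ k : ZMod N, ∑ s : ZMod M, Matrix.trace (Ψ k s) := by
  simp only [pairV, Matrix.trace_sum]

/-- Summation over the torus is invariant under translations. -/
theorem sum_torus_translate {α : Type*} [AddCommMonoid α] [NeZero N] [NeZero M]
    (a : ZMod N) (b : ZMod M) (f : ZMod N → ZMod M → α) :
    ∑ k : ZMod N, ∑ s : ZMod M, f (k + a) (s + b) = ∑ k : ZMod N, ∑ s : ZMod M, f k s := by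
  rw [← Equiv.sum_comp (Equiv.addRight a) fun k => ∑ s, f k s]
  exact Finset.sum_congr rfl fun k _ => Equiv.sum_comp (Equiv.addRight b) (f (k + a))

/-- `tr⟨V, Φ∪Ω⟩ = tr⟨V, Ω∪∗∗Φ⟩` for an `r`-form `Φ` and a `(2−r)`-form
`Ω`, `r = 0, 1, 2`. -/
theorem discrete_trace_pairing_double_star (N M : ℕ) [NeZero N] [NeZero M] :
    (∀ (Φ : Form0 N M) (Ω : Form2 N M),
      Matrix.trace (pairV (cup02 Φ Ω))
        = Matrix.trace (pairV (cup20 Ω (star2 (star0 Φ))))) ∧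
    (∀ (Φ Ω : Form1 N M),
      Matrix.trace (pairV (cup11 Φ Ω))
        = Matrix.trace (pairV (cup11 Ω (star1 (star1 Φ))))) ∧
    (∀ (Φ : Form2 N M) (Ω : Form0 N M),
      Matrix.trace (pairV (cup20 Φ Ω))
        = Matrix.trace (pairV (cup02 Ω (star0 (star2 Φ))))) := by
  refine ⟨fun Φ Ω => ?_, fun Φ Ω => ?_, fun Φ Ω => ?_⟩
  · simp only [trace_pairV, cup02, cup20, star0, star2, add_sub_cancel_right]
    simp only [Matrix.trace_mul_comm (Φ _ _)]
  · simp only [trace_pairV, cup11, star1, Matrix.trace_sub, Matrix.mul_neg, Matrix.trace_neg,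
      add_sub_cancel_right, Finset.sum_sub_distrib, Finset.sum_neg_distrib]
    have h₁ := sum_torus_translate 1 0 fun (k : ZMod N) (s : ZMod M) =>
      Matrix.trace (Ω.2 k s * Φ.1 (k - 1) s)
    have h₂ := sum_torus_translate 0 1 fun (k : ZMod N) (s : ZMod M) =>
      Matrix.trace (Ω.1 k s * Φ.2 k (s - 1))
    simp only [add_sub_cancel_right, add_zero] at h₁ h₂
    simp only [Matrix.trace_mul_comm (Φ.1 _ _), Matrix.trace_mul_comm (Φ.2 _ _)]
    rw [h₁, h₂]
    ring
  · have h := sum_torus_translate 1 1 fun (k : ZMod N) (s : ZMod M) =>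
      Matrix.trace (Ω k s * Φ (k - 1) (s - 1))
    simp only [add_sub_cancel_right] at h
    simp only [trace_pairV, cup02, cup20, star0, star2, Matrix.trace_mul_comm (Φ _ _)]
    exact h
end
end

section
/- For any r-form Φ and any (2−r)-form Ω (r = 0, 1 or 2) on the combinatorial N×M torus, tr⟨V, Φ∪Ω⟩ = tr⟨V, ∗Φ∪∗Ω⟩. -/
open Matrix BigOperators

noncomputable section

variable {N M : ℕ}

section PairingShifts

variable [NeZero N] [NeZero M]

/-- The pairing with the fundamental chain is invariant under translations of the torus. -/
lemma pairV_translate (Ψ : Form2 N M) (a : ZMod N) (b : ZMod M) :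
    pairV (fun k s => Ψ (k + a) (s + b)) = pairV Ψ := by
  unfold pairV
  rw [← Equiv.sum_comp (Equiv.addRight a) fun k => ∑ s, Ψ k s]
  refine Finset.sum_congr rfl fun k _ => ?_
  exact Equiv.sum_comp (Equiv.addRight b) fun s => Ψ (k + a) s

lemma pairV_sub (Ψ Θ : Form2 N M) :
    pairV (fun k s => Ψ k s - Θ k s) = pairV Ψ - pairV Θ := by
  simp only [pairV, Finset.sum_sub_distrib]

lemma pairV_cup11_star1 (Φ Ω : Form1 N M) :
    pairV (cup11 (star1 Φ) (star1 Ω)) = pairV (cup11 Φ Ω) := by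
  have hstar : cup11 (star1 Φ) (star1 Ω) =
      fun k s => Φ.1 (k - 1) s * Ω.2 k s - Φ.2 k (s - 1) * Ω.1 k s := by
    funext k s
    simp only [cup11, star1, add_sub_cancel_right, neg_mul, mul_neg, sub_neg_eq_add]
    abel
  rw [hstar, pairV_sub, ← pairV_translate (fun k s => Φ.1 (k - 1) s * Ω.2 k s) 1 0,
    ← pairV_translate (fun k s => Φ.2 k (s - 1) * Ω.1 k s) 0 1, ← pairV_sub]
  simp only [add_sub_cancel_right, add_zero]
  rfl

lemma pairV_cup02_star2_star0 (Φ : Form2 N M) (Ω : Form0 N M) :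
    pairV (cup02 (star2 Φ) (star0 Ω)) = pairV (cup20 Φ Ω) := by
  rw [← pairV_translate (cup02 (star2 Φ) (star0 Ω)) 1 1]
  simp only [cup02, star2, star0, add_sub_cancel_right]
  rfl

end PairingShifts

lemma cup20_star0_star2 (Φ : Form0 N M) (Ω : Form2 N M) :
    cup20 (star0 Φ) (star2 Ω) = cup02 Φ Ω := by
  funext k s
  simp only [cup20, cup02, star0, star2, add_sub_cancel_right]

/-- `tr⟨V, Φ∪Ω⟩ = tr⟨V, ∗Φ∪∗Ω⟩` for an `r`-form `Φ` and a `(2−r)`-form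
`Ω`, `r = 0, 1, 2`. -/
theorem discrete_trace_pairing_star_invariance (N M : ℕ) [NeZero N] [NeZero M] :
    (∀ (Φ : Form0 N M) (Ω : Form2 N M),
      Matrix.trace (pairV (cup02 Φ Ω))
        = Matrix.trace (pairV (cup20 (star0 Φ) (star2 Ω)))) ∧
    (∀ (Φ Ω : Form1 N M),
      Matrix.trace (pairV (cup11 Φ Ω))
        = Matrix.trace (pairV (cup11 (star1 Φ) (star1 Ω)))) ∧
    (∀ (Φ : Form2 N M) (Ω : Form0 N M),
      Matrix.trace (pairV (cup20 Φ Ω))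
        = Matrix.trace (pairV (cup02 (star2 Φ) (star0 Ω)))) := by
  refine ⟨fun Φ Ω => ?_, fun Φ Ω => ?_, fun Φ Ω => ?_⟩
  · rw [cup20_star0_star2]
  · rw [pairV_cup11_star1]
  · rw [pairV_cup02_star2_star0]
end
end

section
/- For any discrete 1-form A and any r-form Φ with r = 1 or r = 2 on the combinatorial N×M torus, δ_A^cΦ = (−1)^r ∗⁻¹ d_A^c(∗Φ) + ∗⁻¹(∗Φ ∪ (∗∗A + A)). -/
open Matrix BigOperators

noncomputable section

variable {N M : ℕ}

/-- `δ_A^cΦ = (−1)^r ∗⁻¹ d_A^c(∗Φ) + ∗⁻¹(∗Φ ∪ (∗∗A + A))` for `r = 1, 2`. -/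
theorem deltaA_eq_star_dA_star (N M : ℕ) [NeZero N] [NeZero M] (A : Form1 N M) :
    (∀ Φ : Form1 N M,
      deltaA1 A Φ
        = -(starInv2 (dA1 A (star1 Φ)))
          + starInv2 (cup11 (star1 Φ) (star1 (star1 A) + A))) ∧
    (∀ Φ : Form2 N M,
      deltaA2 A Φ
        = starInv1 (dA0 A (star2 Φ))
          + starInv1 (cup01 (star2 Φ) (star1 (star1 A) + A))) := by
  refine ⟨fun Φ => ?_, fun Φ => ?_⟩
  · funext k s
    simp only [deltaA1, delta1, dA1, d1, cup11, star1, starInv2, Pi.add_apply, Pi.sub_apply,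
      Pi.neg_apply, Prod.fst_add, Prod.snd_add, mul_add, add_sub_cancel_right]
    abel
  · ext1 <;> funext k s <;>
    · simp only [deltaA2, delta2, dA0, d0, cup01, cup10, star1, star2, starInv1, Pi.add_apply,
        Pi.sub_apply, Prod.fst_add, Prod.snd_add, Prod.fst_sub, Prod.snd_sub, mul_add,
        add_sub_cancel_right]
      abel
end
end
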